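/- arXiv:1806.11148 — 6 statements merged into one kernel-verified Lean document; each statement's English description precedes it below -/
import Mathlib

section
/- Let f be an S-invariant. Then in ℝ[[t]] one has the identity ∏_{i=1}^k (1 − t^{n_i}) · Σ_{n ≥ 0} f(n) t^n = Σ_{n ≥ 0} χ_f(Δ_n) t^n, where χ_f(Δ_n) = Σ_{F ⊆ {1,…,k}, n − n_F ∈ S} (−1)^{|F|} f(n − n_F). -/
open scoped Classical

/-- The numerical semigroup generated by `n 0, …, n (k-1)`, viewed as a subset of `ℤ`. -/
def SemigroupSet (k : ℕ) (n : Fin k → ℕ) : Set ℤ :=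
  {z | ∃ a : Fin k → ℕ, z = ∑ i, (a i : ℤ) * (n i : ℤ)}

/-- The weighted Euler characteristic `χ_f(Δ_z) = Σ_{F ⊆ [k], z - n_F ∈ S} (-1)^{|F|} f(z - n_F)`. -/
noncomputable def weightedEuler (k : ℕ) (n : Fin k → ℕ) (f : ℤ → ℝ) (z : ℤ) : ℝ :=
  ∑ F : Finset (Fin k),
    if (z - ∑ i ∈ F, (n i : ℤ)) ∈ SemigroupSet k n then
      (-1 : ℝ) ^ F.card * f (z - ∑ i ∈ F, (n i : ℤ))
    else 0

/-- For an `S`-invariant `f`, one has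
`∏_{i=1}^k (1 - t^{n_i}) · Σ_{n ≥ 0} f(n) tⁿ = Σ_{n ≥ 0} χ_f(Δ_n) tⁿ` in `ℝ[[t]]`. -/
theorem stmt1 (k : ℕ) (hk : 0 < k) (n : Fin k → ℕ)
    (hpos : ∀ i, 0 < n i) (hmono : StrictMono n)
    (hgcd : Finset.univ.gcd n = 1)
    (f : ℤ → ℝ) (hf : ∀ z : ℤ, z ∉ SemigroupSet k n → f z = 0) :
    (∏ i, (1 - (PowerSeries.X : PowerSeries ℝ) ^ (n i))) *
        PowerSeries.mk (fun m : ℕ => f (m : ℤ)) =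
      PowerSeries.mk (fun m : ℕ => weightedEuler k n f (m : ℤ)) := by
  ext m
  have hprod : ∏ i, (1 - (PowerSeries.X : PowerSeries ℝ) ^ (n i)) =
      ∑ F : Finset (Fin k),
        PowerSeries.C ((-1 : ℝ) ^ F.card) * PowerSeries.X ^ (∑ i ∈ F, n i) := by
    simp only [sub_eq_add_neg]
    rw [Finset.prod_one_add, Finset.powerset_univ]
    refine Finset.sum_congr rfl fun F _ => ?_
    rw [Finset.prod_neg, Finset.prod_pow_eq_pow_sum]
    simp
  rw [hprod, Finset.sum_mul, map_sum, PowerSeries.coeff_mk, weightedEuler]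
  refine Finset.sum_congr rfl fun F _ => ?_
  rw [mul_assoc, PowerSeries.coeff_C_mul, PowerSeries.coeff_X_pow_mul']
  have hcast : (∑ i ∈ F, (n i : ℤ)) = ((∑ i ∈ F, n i : ℕ) : ℤ) := by push_cast; rfl
  rw [hcast]
  split_ifs with hle hmem hmem
  · rw [PowerSeries.coeff_mk, Nat.cast_sub hle]
  · rw [PowerSeries.coeff_mk, Nat.cast_sub hle, hf _ hmem, mul_zero]
  · obtain ⟨a, ha⟩ := hmem
    have hnonneg : (0 : ℤ) ≤ ∑ i, (a i : ℤ) * (n i : ℤ) := by positivity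
    omega
  · rw [mul_zero]
end

section
/- Let f be an S-invariant. Then in ℝ[[t]] one has the identity ∏_{i=1}^k (1 − t^{n_i}) · Σ_{n ≥ 0} f(n) t^n = ( Σ_{i=1}^k t^{n_i} ∏_{j ≠ i} (1 − t^{n_j}) ) · Σ_{n ∈ S} t^n + Σ_{n ≥ 0} χ̂_f(Δ_n) t^n, where χ̂_f(Δ_n) = Σ_{F ⊆ {1,…,k}, n − n_F ∈ S} (−1)^{|F|} ( f(n − n_F) + |F| ). -/
open scoped Classical

/-- The augmented Euler characteristic
`χ̂_f(Δ_z) = Σ_{F ⊆ [k], z - n_F ∈ S} (-1)^{|F|} (f(z - n_F) + |F|)`. -/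
noncomputable def augmentedEuler (k : ℕ) (n : Fin k → ℕ) (f : ℤ → ℝ) (z : ℤ) : ℝ :=
  ∑ F : Finset (Fin k),
    if (z - ∑ i ∈ F, (n i : ℤ)) ∈ SemigroupSet k n then
      (-1 : ℝ) ^ F.card * (f (z - ∑ i ∈ F, (n i : ℤ)) + (F.card : ℝ))
    else 0

/-- Expansion over subsets of the sum of `xᵢ ∏ (1 - xⱼ)`, `j ≠ i`; it follows by differentiating
`∏ (1 - xᵢ T)` at `T = 1`. -/
theorem Finset.sum_mul_prod_erase_one_sub {ι R : Type*} [Fintype ι] [DecidableEq ι] [CommRing R]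
    (x : ι → R) :
    ∑ i, x i * ∏ j ∈ Finset.univ.erase i, (1 - x j) =
      -∑ F : Finset ι, (-1) ^ F.card * (F.card : R) * ∏ i ∈ F, x i := by
  open Polynomial in
  have expand : ∏ i, (1 - C (x i) * X) =
      ∑ F : Finset ι, C ((-1) ^ F.card * ∏ i ∈ F, x i) * X ^ F.card := by
    simp_rw [sub_eq_add_neg, Finset.prod_one_add, Finset.powerset_univ, Finset.prod_neg,
      Finset.prod_mul_distrib, Finset.prod_const, map_mul, map_prod, map_pow, map_neg, map_one,
      mul_assoc]
  have key := congrArg (fun p => p.derivative.eval 1) expand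
  simp only [Polynomial.derivative_prod_finset, Polynomial.derivative_sum,
    Polynomial.derivative_C_mul_X_pow] at key
  simp [Polynomial.eval_finsetSum, Polynomial.eval_prod] at key
  rw [← neg_eq_iff_eq_neg]
  refine (congrArg Neg.neg (Finset.sum_congr rfl fun i _ => ?_)).trans
    (key.trans (Finset.sum_congr rfl fun F _ => ?_)) <;> ring

/-- Multiplication of a generating function by a signed sum of monomials, coefficientwise. -/
theorem PowerSeries.coeff_sum_monomial_mul_mk {ι R : Type*} [CommRing R] (s : Finset ι)
    (c : ι → R) (d : ι → ℕ) (g : ℤ → R) (hg : ∀ z < 0, g z = 0) (m : ℕ) :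
    PowerSeries.coeff m
        ((∑ a ∈ s, PowerSeries.C (c a) * PowerSeries.X ^ d a) *
          PowerSeries.mk fun j : ℕ => g j) =
      ∑ a ∈ s, c a * g (m - d a) := by
  rw [Finset.sum_mul, map_sum]
  refine Finset.sum_congr rfl fun a _ => ?_
  rw [mul_assoc, PowerSeries.coeff_C_mul, PowerSeries.coeff_X_pow_mul']
  split_ifs with h
  · rw [PowerSeries.coeff_mk, Nat.cast_sub h]
  · rw [hg _ (by omega)]

theorem SemigroupSet.nonneg {k : ℕ} {n : Fin k → ℕ} {z : ℤ} (hz : z ∈ SemigroupSet k n) :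
    0 ≤ z := by
  obtain ⟨a, rfl⟩ := hz
  positivity

/-- For an `S`-invariant `f`, in `ℝ[[t]]` one has
`∏_{i=1}^k (1 - t^{n_i}) · Σ_{n ≥ 0} f(n) tⁿ
  = (Σ_{i=1}^k t^{n_i} ∏_{j≠i} (1 - t^{n_j})) · Σ_{n ∈ S} tⁿ + Σ_{n ≥ 0} χ̂_f(Δ_n) tⁿ`. -/
theorem stmt3 (k : ℕ) (hk : 0 < k) (n : Fin k → ℕ)
    (hpos : ∀ i, 0 < n i) (hmono : StrictMono n)
    (hgcd : Finset.univ.gcd n = 1)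
    (f : ℤ → ℝ) (hf : ∀ z : ℤ, z ∉ SemigroupSet k n → f z = 0) :
    (∏ i, (1 - (PowerSeries.X : PowerSeries ℝ) ^ (n i))) *
        PowerSeries.mk (fun m : ℕ => f (m : ℤ)) =
      (∑ i, (PowerSeries.X : PowerSeries ℝ) ^ (n i) *
          ∏ j ∈ Finset.univ.erase i, (1 - (PowerSeries.X : PowerSeries ℝ) ^ (n j))) *
        PowerSeries.mk (fun m : ℕ => if (m : ℤ) ∈ SemigroupSet k n then (1 : ℝ) else 0) +
      PowerSeries.mk (fun m : ℕ => augmentedEuler k n f (m : ℤ)) := by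
  have hprod : ∏ i, (1 - (PowerSeries.X : PowerSeries ℝ) ^ n i) =
      ∑ F : Finset (Fin k),
        PowerSeries.C ((-1 : ℝ) ^ F.card) * PowerSeries.X ^ ∑ i ∈ F, n i := by
    simp_rw [sub_eq_add_neg, Finset.prod_one_add, Finset.powerset_univ, Finset.prod_neg,
      Finset.prod_pow_eq_pow_sum, map_pow, map_neg, map_one]
  have hsum : ∑ i, (PowerSeries.X : PowerSeries ℝ) ^ n i *
        ∏ j ∈ Finset.univ.erase i, (1 - (PowerSeries.X : PowerSeries ℝ) ^ n j) =
      ∑ F : Finset (Fin k),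
        PowerSeries.C (-((-1 : ℝ) ^ F.card * F.card)) * PowerSeries.X ^ ∑ i ∈ F, n i := by
    rw [Finset.sum_mul_prod_erase_one_sub, ← Finset.sum_neg_distrib]
    simp_rw [Finset.prod_pow_eq_pow_sum, map_neg, map_mul, map_pow, map_neg, map_one, map_natCast,
      neg_mul]
  ext m
  rw [hprod, hsum, map_add,
    PowerSeries.coeff_sum_monomial_mul_mk _ _ _ f
      fun z hz => hf z fun h => hz.not_ge (SemigroupSet.nonneg h),
    PowerSeries.coeff_sum_monomial_mul_mk _ _ _
      (fun z => if z ∈ SemigroupSet k n then (1 : ℝ) else 0)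
      fun z hz => if_neg fun h => hz.not_ge (SemigroupSet.nonneg h),
    PowerSeries.coeff_mk, augmentedEuler, ← Finset.sum_add_distrib]
  refine Finset.sum_congr rfl fun F _ => ?_
  push_cast
  split_ifs with h
  · ring
  · rw [hf _ h]
    ring
end

section
/- In ℤ[[t]] one has the identity ( Σ_{i=1}^k t^{n_i} ∏_{j ≠ i} (1 − t^{n_j}) ) · Σ_{m ≥ 0} χ(Δ_m) t^m + ∏_{j=1}^k (1 − t^{n_j}) · Σ_{m ≥ 0} ( Σ_{F ⊆ {1,…,k}, m − n_F ∈ S} (−1)^{|F|} |F| ) t^m = 0, where χ(Δ_m) = Σ_{F ⊆ {1,…,k}, m − n_F ∈ S} (−1)^{|F|}. -/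
open scoped Classical

/-- The Euler characteristic `χ(Δ_z) = Σ_{F ⊆ [k], z - n_F ∈ S} (-1)^{|F|}`. -/
noncomputable def eulerChar (k : ℕ) (n : Fin k → ℕ) (z : ℤ) : ℤ :=
  ∑ F : Finset (Fin k),
    if (z - ∑ i ∈ F, (n i : ℤ)) ∈ SemigroupSet k n then (-1 : ℤ) ^ F.card else 0

/-- `Σ_{F ⊆ [k], z - n_F ∈ S} (-1)^{|F|} |F|`. -/
noncomputable def cardWeightedEuler (k : ℕ) (n : Fin k → ℕ) (z : ℤ) : ℤ :=
  ∑ F : Finset (Fin k),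
    if (z - ∑ i ∈ F, (n i : ℤ)) ∈ SemigroupSet k n then
      (-1 : ℤ) ^ F.card * (F.card : ℤ)
    else 0

/-- Signed subset expansion of `∏ (1 - x j)`. -/
theorem sum_powerset_neg_one_pow_card_mul_prod {ι R : Type*} [CommRing R] (s : Finset ι)
    (x : ι → R) :
    ∑ F ∈ s.powerset, (-1 : R) ^ F.card * ∏ i ∈ F, x i = ∏ i ∈ s, (1 - x i) := by
  induction s using Finset.induction_on with
  | empty => simp
  | insert a s ha ih =>
    rw [Finset.sum_powerset_insert ha, Finset.prod_insert ha, ← ih, sub_mul, one_mul,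
      sub_eq_add_neg, Finset.mul_sum, ← Finset.sum_neg_distrib]
    congr 1
    refine Finset.sum_congr rfl fun F hF => ?_
    have haF : a ∉ F := fun h => ha (Finset.mem_powerset.mp hF h)
    rw [Finset.card_insert_of_notMem haF, Finset.prod_insert haF]
    ring

/-- The expansion of `∏ (1 - x j)` weighted by the sizes of the subsets. -/
theorem sum_powerset_neg_one_pow_card_mul_card_mul_prod {ι R : Type*} [CommRing R]
    (s : Finset ι) (x : ι → R) :
    ∑ F ∈ s.powerset, (-1 : R) ^ F.card * (F.card : R) * ∏ i ∈ F, x i =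
      -∑ i ∈ s, x i * ∏ j ∈ s.erase i, (1 - x j) := by
  induction s using Finset.induction_on with
  | empty => simp
  | insert a s ha ih =>
    have hinsert : ∑ F ∈ s.powerset, (-1 : R) ^ (insert a F).card *
          ((insert a F).card : R) * ∏ i ∈ insert a F, x i =
        -x a * ∑ F ∈ s.powerset, (-1 : R) ^ F.card * (F.card : R) * ∏ i ∈ F, x i -
          x a * ∑ F ∈ s.powerset, (-1 : R) ^ F.card * ∏ i ∈ F, x i := by
      rw [Finset.mul_sum, Finset.mul_sum, ← Finset.sum_sub_distrib]
      refine Finset.sum_congr rfl fun F hF => ?_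
      have haF : a ∉ F := fun h => ha (Finset.mem_powerset.mp hF h)
      rw [Finset.card_insert_of_notMem haF, Finset.prod_insert haF]
      push_cast
      ring
    have herase : ∑ i ∈ s, x i * ∏ j ∈ (insert a s).erase i, (1 - x j) =
        (1 - x a) * ∑ i ∈ s, x i * ∏ j ∈ s.erase i, (1 - x j) := by
      rw [Finset.mul_sum]
      refine Finset.sum_congr rfl fun i hi => ?_
      have hai : a ≠ i := fun h => ha (h ▸ hi)
      rw [Finset.erase_insert_of_ne hai,
        Finset.prod_insert fun h => ha (Finset.mem_of_mem_erase h)]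
      ring
    rw [Finset.sum_powerset_insert ha, hinsert, ih, sum_powerset_neg_one_pow_card_mul_prod,
      Finset.sum_insert ha, herase, Finset.erase_insert ha]
    ring

/-- The Hilbert series of the semigroup generated by `n`. -/
noncomputable def hilbertSeries (k : ℕ) (n : Fin k → ℕ) : PowerSeries ℤ :=
  PowerSeries.mk fun m : ℕ => if (m : ℤ) ∈ SemigroupSet k n then 1 else 0

theorem mk_sum_ite_mem_semigroupSet (k : ℕ) (n : Fin k → ℕ) (w : Finset (Fin k) → ℤ) :
    PowerSeries.mk (fun m : ℕ => ∑ F : Finset (Fin k),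
        if ((m : ℤ) - ∑ i ∈ F, (n i : ℤ)) ∈ SemigroupSet k n then w F else 0) =
      (∑ F : Finset (Fin k), (w F : PowerSeries ℤ) *
        ∏ i ∈ F, (PowerSeries.X : PowerSeries ℤ) ^ n i) * hilbertSeries k n := by
  ext m
  rw [PowerSeries.coeff_mk, Finset.sum_mul, map_sum]
  refine Finset.sum_congr rfl fun F _ => ?_
  rw [Finset.prod_pow_eq_pow_sum, mul_assoc, ← zsmul_eq_mul, map_zsmul,
    PowerSeries.coeff_X_pow_mul', hilbertSeries, PowerSeries.coeff_mk]
  by_cases h : ∑ i ∈ F, n i ≤ m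
  · simp [h]
  · have hnot : (m : ℤ) - ∑ i ∈ F, (n i : ℤ) ∉ SemigroupSet k n := fun hz => h <| by
      have := SemigroupSet.nonneg hz
      zify
      linarith
    simp [h, hnot]

/-- In `ℤ[[t]]`,
`(Σ_{i=1}^k t^{n_i} ∏_{j≠i} (1 - t^{n_j})) · Σ_{m ≥ 0} χ(Δ_m) tᵐ
  + ∏_{j=1}^k (1 - t^{n_j}) · Σ_{m ≥ 0} (Σ_{F ∈ Δ_m} (-1)^{|F|}|F|) tᵐ = 0`. -/
theorem stmt4 (k : ℕ) (hk : 0 < k) (n : Fin k → ℕ)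
    (hpos : ∀ i, 0 < n i) (hmono : StrictMono n)
    (hgcd : Finset.univ.gcd n = 1) :
    (∑ i, (PowerSeries.X : PowerSeries ℤ) ^ (n i) *
          ∏ j ∈ Finset.univ.erase i, (1 - (PowerSeries.X : PowerSeries ℤ) ^ (n j))) *
        PowerSeries.mk (fun m : ℕ => eulerChar k n (m : ℤ)) +
      (∏ j, (1 - (PowerSeries.X : PowerSeries ℤ) ^ (n j))) *
        PowerSeries.mk (fun m : ℕ => cardWeightedEuler k n (m : ℤ)) = 0 := by
  have hchi : PowerSeries.mk (fun m : ℕ => eulerChar k n (m : ℤ)) =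
      (∏ j, (1 - (PowerSeries.X : PowerSeries ℤ) ^ n j)) * hilbertSeries k n := by
    simp only [eulerChar]
    rw [mk_sum_ite_mem_semigroupSet k n fun F => (-1) ^ F.card,
      ← sum_powerset_neg_one_pow_card_mul_prod, Finset.powerset_univ]
    push_cast
    rfl
  have hcard : PowerSeries.mk (fun m : ℕ => cardWeightedEuler k n (m : ℤ)) =
      (-∑ i, (PowerSeries.X : PowerSeries ℤ) ^ n i *
        ∏ j ∈ Finset.univ.erase i, (1 - (PowerSeries.X : PowerSeries ℤ) ^ n j)) *
          hilbertSeries k n := by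
    simp only [cardWeightedEuler]
    rw [mk_sum_ite_mem_semigroupSet k n fun F => (-1) ^ F.card * (F.card : ℤ)]
    have h := sum_powerset_neg_one_pow_card_mul_card_mul_prod Finset.univ
      fun i => (PowerSeries.X : PowerSeries ℤ) ^ n i
    rw [Finset.powerset_univ] at h
    push_cast
    congr 1
    convert h
  rw [hchi, hcard]
  ring
end

section
/- Let S₁ and S₂ be numerical semigroups, let d₁ ∈ S₂ and d₂ ∈ S₁ be positive integers with gcd(d₁, d₂) = 1, and let S = d₁S₁ + d₂S₂. Suppose that for every n ∈ S, writing n = d₁n′ + d₂n″ with n′ ∈ S₁ and n″ ∈ Ap(S₂; d₁), one has M_S(n) = M_{S₁}(n′) + M_{S₂}(n″) (an M-harmonic gluing). Then in ℤ[[t]]: Σ_{n ∈ S} M_S(n) t^n = ( Σ_{n ∈ S₁} t^{d₁ n} ) · ( Σ_{n ∈ Ap(S₂;d₁)} M_{S₂}(n) t^{d₂ n} ) + ( Σ_{n ∈ S₁} M_{S₁}(n) t^{d₁ n} ) · ( Σ_{n ∈ Ap(S₂;d₁)} t^{d₂ n} ). -/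
open scoped Classical

/-- The additive submonoid of `ℕ` generated by `g 0, …, g (k-1)`. -/
def SemOf (k : ℕ) (g : Fin k → ℕ) : Set ℕ :=
  {m | ∃ a : Fin k → ℕ, m = ∑ i, a i * g i}

/-- The set of factorization lengths of `m` over the generators `g 0, …, g (k-1)`. -/
def LenOf (k : ℕ) (g : Fin k → ℕ) (m : ℕ) : Set ℕ :=
  {l | ∃ a : Fin k → ℕ, (∑ i, a i * g i) = m ∧ (∑ i, a i) = l}

/-- The set of factorization lengths of `m` over the combined generators
`d₁·g₁ i` and `d₂·g₂ j` of the gluing `S = d₁S₁ + d₂S₂`. -/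
def LenGlue (k₁ k₂ : ℕ) (g₁ : Fin k₁ → ℕ) (g₂ : Fin k₂ → ℕ) (d₁ d₂ : ℕ) (m : ℕ) : Set ℕ :=
  {l | ∃ a : Fin k₁ → ℕ, ∃ b : Fin k₂ → ℕ,
    (∑ i, a i * (d₁ * g₁ i)) + (∑ j, b j * (d₂ * g₂ j)) = m ∧
    (∑ i, a i) + (∑ j, b j) = l}

theorem SemOf.add_mem {k : ℕ} {g : Fin k → ℕ} {x y : ℕ} (hx : x ∈ SemOf k g)
    (hy : y ∈ SemOf k g) : x + y ∈ SemOf k g := by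
  obtain ⟨a, rfl⟩ := hx
  obtain ⟨b, rfl⟩ := hy
  exact ⟨fun i => a i + b i, by simp [add_mul, Finset.sum_add_distrib]⟩

theorem SemOf.add_mul_mem {k : ℕ} {g : Fin k → ℕ} {x y : ℕ} (hx : x ∈ SemOf k g)
    (hy : y ∈ SemOf k g) (c : ℕ) : x + c * y ∈ SemOf k g := by
  induction c with
  | zero => simpa using hx
  | succ c ih => simpa [add_mul, add_assoc] using SemOf.add_mem ih hy

/-- Every element of a set `T` is an element of its Apéry set at `d` plus a multiple of `d`. -/
theorem exists_apery_add_mul {T : Set ℕ} {d : ℕ} (hd : 0 < d) (y : ℕ) (hy : y ∈ T) :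
    ∃ z ∈ {x ∈ T | ¬ ∃ y ∈ T, x = y + d}, ∃ c, y = z + c * d := by
  induction y using Nat.strong_induction_on with
  | _ y ih =>
    by_cases h : ∃ w ∈ T, y = w + d
    · obtain ⟨w, hw, rfl⟩ := h
      obtain ⟨z, hz, c, rfl⟩ := ih w (by omega) hw
      exact ⟨z, hz, c + 1, by ring⟩
    · exact ⟨y, ⟨hy, h⟩, 0, by simp⟩

/-- Apéry elements of `SemOf k g` at `d` that are congruent modulo `d` are not strictly ordered. -/
theorem apery_le_of_modEq {k : ℕ} {g : Fin k → ℕ} {d y z : ℕ}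
    (hd : d ∈ SemOf k g) (hy : y ∈ SemOf k g)
    (hz : ¬ ∃ w ∈ SemOf k g, z = w + d) (hyz : y ≡ z [MOD d]) : z ≤ y := by
  by_contra! hlt
  obtain ⟨c, hc⟩ := (Nat.modEq_iff_dvd' hlt.le).1 hyz
  obtain _ | c := c
  · simp at hc
    omega
  · refine hz ⟨y + c * d, SemOf.add_mul_mem hy hd c, ?_⟩
    have : d * (c + 1) = c * d + d := by ring
    omega

/-- For an `M`-harmonic gluing `S = d₁S₁ + d₂S₂`,
`Σ_{n ∈ S} M_S(n) tⁿ = (Σ_{n ∈ S₁} t^{d₁n})(Σ_{n ∈ Ap(S₂;d₁)} M_{S₂}(n) t^{d₂n})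
  + (Σ_{n ∈ S₁} M_{S₁}(n) t^{d₁n})(Σ_{n ∈ Ap(S₂;d₁)} t^{d₂n})` in `ℤ[[t]]`. -/
theorem stmt11 (k₁ k₂ : ℕ) (hk₁ : 0 < k₁) (hk₂ : 0 < k₂)
    (g₁ : Fin k₁ → ℕ) (g₂ : Fin k₂ → ℕ)
    (hg₁pos : ∀ i, 0 < g₁ i) (hg₂pos : ∀ j, 0 < g₂ j)
    (hg₁gcd : Finset.univ.gcd g₁ = 1) (hg₂gcd : Finset.univ.gcd g₂ = 1)
    (d₁ d₂ : ℕ) (hd₁pos : 0 < d₁) (hd₂pos : 0 < d₂)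
    (hd₁ : d₁ ∈ SemOf k₂ g₂) (hd₂ : d₂ ∈ SemOf k₁ g₁)
    (hcop : Nat.gcd d₁ d₂ = 1)
    -- notation: the two semigroups, the gluing, the Apéry set, and the length functions
    (S₁ S₂ S Ap₂ : Set ℕ) (M M₁ M₂ : ℕ → ℕ)
    (hS₁ : S₁ = SemOf k₁ g₁) (hS₂ : S₂ = SemOf k₂ g₂)
    (hS : S = {m | ∃ x ∈ S₁, ∃ y ∈ S₂, m = d₁ * x + d₂ * y})
    (hAp₂ : Ap₂ = {x ∈ S₂ | ¬ ∃ y ∈ S₂, x = y + d₁})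
    (hM : ∀ m, M m = sSup (LenGlue k₁ k₂ g₁ g₂ d₁ d₂ m))
    (hM₁ : ∀ m, M₁ m = sSup (LenOf k₁ g₁ m))
    (hM₂ : ∀ m, M₂ m = sSup (LenOf k₂ g₂ m))
    -- the `M`-harmonic gluing hypothesis
    (hharm : ∀ m ∈ S, ∀ n' ∈ S₁, ∀ n'' ∈ Ap₂,
      m = d₁ * n' + d₂ * n'' → M m = M₁ n' + M₂ n'') :
    PowerSeries.mk (fun m : ℕ => if m ∈ S then (M m : ℤ) else 0) =
      PowerSeries.mk (fun m : ℕ => if d₁ ∣ m ∧ m / d₁ ∈ S₁ then (1 : ℤ) else 0) *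
        PowerSeries.mk (fun m : ℕ =>
          if d₂ ∣ m ∧ m / d₂ ∈ Ap₂ then (M₂ (m / d₂) : ℤ) else 0) +
      PowerSeries.mk (fun m : ℕ =>
          if d₁ ∣ m ∧ m / d₁ ∈ S₁ then (M₁ (m / d₁) : ℤ) else 0) *
        PowerSeries.mk (fun m : ℕ => if d₂ ∣ m ∧ m / d₂ ∈ Ap₂ then (1 : ℤ) else 0) := by
  subst hS₁ hS₂ hAp₂
  have hunique : ∀ x y x' y' : ℕ, y ∈ {x ∈ SemOf k₂ g₂ | ¬ ∃ y ∈ SemOf k₂ g₂, x = y + d₁} →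
      y' ∈ {x ∈ SemOf k₂ g₂ | ¬ ∃ y ∈ SemOf k₂ g₂, x = y + d₁} →
      d₁ * x + d₂ * y = d₁ * x' + d₂ * y' → y = y' := by
    intro x y x' y' hy hy' h
    have hmod : y ≡ y' [MOD d₁] := by
      refine Nat.ModEq.cancel_left_of_coprime (c := d₂) hcop ?_
      have := congrArg (· % d₁) h
      simpa [Nat.ModEq, Nat.mul_add_mod] using this
    exact le_antisymm (apery_le_of_modEq hd₁ hy'.1 hy.2 hmod.symm)
      (apery_le_of_modEq hd₁ hy.1 hy'.2 hmod)
  ext m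
  simp only [map_add, PowerSeries.coeff_mul, PowerSeries.coeff_mk, ← Finset.sum_add_distrib]
  by_cases hm : m ∈ S
  · have hm' := hm
    rw [hS] at hm'
    obtain ⟨x, hx, y, hy, hxy⟩ := hm'
    obtain ⟨z, hz, c, rfl⟩ := exists_apery_add_mul hd₁pos y hy
    have hx' : x + c * d₂ ∈ SemOf k₁ g₁ := SemOf.add_mul_mem hx hd₂ c
    have hxz : m = d₁ * (x + c * d₂) + d₂ * z := by rw [hxy]; ring
    rw [Finset.sum_eq_single (d₁ * (x + c * d₂), d₂ * z)]
    · have hval := hharm m hm _ hx' z hz hxz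
      simp only [dvd_mul_right, true_and, Nat.mul_div_cancel_left _ hd₁pos,
        Nat.mul_div_cancel_left _ hd₂pos, if_pos hm, if_pos hx', if_pos hz, hval]
      push_cast
      ring
    · rintro ⟨p, q⟩ hpq hne
      rw [Finset.HasAntidiagonal.mem_antidiagonal] at hpq
      by_cases hp : d₁ ∣ p ∧ p / d₁ ∈ SemOf k₁ g₁
      · by_cases hq : d₂ ∣ q ∧ q / d₂ ∈ {x ∈ SemOf k₂ g₂ | ¬ ∃ y ∈ SemOf k₂ g₂, x = y + d₁}
        · refine absurd ?_ hne
          have hzq := hunique (p / d₁) (q / d₂) (x + c * d₂) z hq.2 hz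
            (by rw [Nat.mul_div_cancel' hp.1, Nat.mul_div_cancel' hq.1, ← hxz]; exact hpq)
          have hqz : q = d₂ * z := by rw [← hzq, Nat.mul_div_cancel' hq.1]
          simp only [Prod.mk.injEq]
          dsimp only at hpq
          omega
        · simp only [if_neg hq, mul_zero, add_zero]
      · simp only [if_neg hp, zero_mul, add_zero]
    · intro h
      exact absurd (Finset.HasAntidiagonal.mem_antidiagonal.2 hxz.symm) h
  · rw [if_neg hm, Finset.sum_eq_zero]
    rintro ⟨p, q⟩ hpq
    rw [Finset.HasAntidiagonal.mem_antidiagonal] at hpq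
    by_cases hp : d₁ ∣ p ∧ p / d₁ ∈ SemOf k₁ g₁
    · by_cases hq : d₂ ∣ q ∧ q / d₂ ∈ {x ∈ SemOf k₂ g₂ | ¬ ∃ y ∈ SemOf k₂ g₂, x = y + d₁}
      · refine absurd ?_ hm
        rw [hS]
        exact ⟨p / d₁, hp.2, q / d₂, hq.2.1, by
          rw [Nat.mul_div_cancel' hp.1, Nat.mul_div_cancel' hq.1]; exact hpq.symm⟩
      · simp only [if_neg hq, mul_zero, add_zero]
    · simp only [if_neg hp, zero_mul, add_zero]
end

section
/- Let S₁ and S₂ be numerical semigroups, let d₁ ∈ S₂ and d₂ ∈ S₁ be positive integers with gcd(d₁, d₂) = 1, and let S = d₁S₁ + d₂S₂. Then in ℤ[[t]]: Σ_{n ∈ S} t^n = (1 − t^{d₁d₂}) · ( Σ_{n ∈ S₁} t^{d₁ n} ) · ( Σ_{n ∈ S₂} t^{d₂ n} ). -/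
open scoped Classical

/-- A numerical semigroup: a cofinite additive subsemigroup of `ℤ≥0` containing `0`. -/
def IsNumericalSemigroup (T : Set ℕ) : Prop :=
  0 ∈ T ∧ (∀ a ∈ T, ∀ b ∈ T, a + b ∈ T) ∧ (Tᶜ).Finite

/-- The Apéry set of `T` with respect to `d`. -/
def aperySet (T : Set ℕ) (d : ℕ) : Set ℕ := {a | a ∈ T ∧ ∀ c ∈ T, a ≠ c + d}

theorem dvd_and_div_mem_iff {d : ℕ} (hd : 0 < d) (T : Set ℕ) (m : ℕ) :
    (d ∣ m ∧ m / d ∈ T) ↔ ∃ a ∈ T, m = d * a := by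
  constructor
  · rintro ⟨⟨a, rfl⟩, h⟩
    rw [Nat.mul_div_cancel_left a hd] at h
    exact ⟨a, h, rfl⟩
  · rintro ⟨a, h, rfl⟩
    rw [Nat.mul_div_cancel_left a hd]
    exact ⟨dvd_mul_right d a, h⟩

theorem one_sub_X_pow_mul_mk_eq_apery {T : Set ℕ} {d e : ℕ} (hd : 0 < d)
    (hT : ∀ a ∈ T, a + e ∈ T) :
    (1 - (PowerSeries.X : PowerSeries ℤ) ^ (d * e)) *
        PowerSeries.mk (fun m : ℕ => if d ∣ m ∧ m / d ∈ T then (1 : ℤ) else 0) =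
      PowerSeries.mk (fun m : ℕ => if ∃ a ∈ aperySet T e, m = d * a then (1 : ℤ) else 0) := by
  ext n
  simp only [sub_mul, one_mul, map_sub, PowerSeries.coeff_X_pow_mul', PowerSeries.coeff_mk,
    dvd_and_div_mem_iff hd]
  by_cases hn : ∃ a ∈ T, n = d * a
  · obtain ⟨a, ha, rfl⟩ := hn
    have key : (∃ c ∈ T, a = c + e) ↔ d * e ≤ d * a ∧ ∃ c ∈ T, d * a - d * e = d * c := by
      constructor
      · rintro ⟨c, hc, rfl⟩
        exact ⟨Nat.mul_le_mul_left d (Nat.le_add_left e c), c, hc, by rw [mul_add]; omega⟩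
      · rintro ⟨hle, c, hc, h⟩
        refine ⟨c, hc, Nat.eq_of_mul_eq_mul_left hd ?_⟩
        rw [mul_add]; omega
    have apery : (∃ b ∈ aperySet T e, d * a = d * b) ↔ ¬ ∃ c ∈ T, a = c + e := by
      constructor
      · rintro ⟨b, hb, h⟩ ⟨c, hc, hac⟩
        obtain rfl := Nat.eq_of_mul_eq_mul_left hd h
        exact hb.2 c hc hac
      · intro h
        exact ⟨a, ⟨ha, fun c hc hac => h ⟨c, hc, hac⟩⟩, rfl⟩
    have self : ∃ b ∈ T, d * a = d * b := ⟨a, ha, rfl⟩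
    rw [if_pos self, ← ite_and]
    by_cases hc : ∃ c ∈ T, a = c + e
    · rw [if_pos (key.1 hc), if_neg (fun h => apery.1 h hc), sub_self]
    · rw [if_neg (fun h => hc (key.2 h)), if_pos (apery.2 hc), sub_zero]
  · have shifted : ¬ (d * e ≤ n ∧ ∃ c ∈ T, n - d * e = d * c) := by
      rintro ⟨hle, c, hc, h⟩
      exact hn ⟨c + e, hT c hc, by rw [mul_add]; omega⟩
    have apery : ¬ ∃ b ∈ aperySet T e, n = d * b := fun ⟨b, hb, h⟩ => hn ⟨b, hb.1, h⟩
    rw [if_neg hn, ← ite_and, if_neg shifted, if_neg apery, sub_zero]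

theorem mk_indicator_mul_mk_indicator {P Q R : ℕ → Prop} [DecidablePred P]
    [DecidablePred Q] [DecidablePred R]
    (hR : ∀ n, R n ↔ ∃ i j, P i ∧ Q j ∧ i + j = n)
    (huniq : ∀ i j i' j', P i → Q j → P i' → Q j' → i + j = i' + j' → i = i') :
    PowerSeries.mk (fun m : ℕ => if P m then (1 : ℤ) else 0) *
        PowerSeries.mk (fun m : ℕ => if Q m then (1 : ℤ) else 0) =
      PowerSeries.mk (fun m : ℕ => if R m then (1 : ℤ) else 0) := by
  ext n
  simp only [PowerSeries.coeff_mul, PowerSeries.coeff_mk, ← ite_and, ite_mul, one_mul, zero_mul]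
  by_cases hn : R n
  · obtain ⟨i, j, hi, hj, hij⟩ := (hR n).1 hn
    rw [if_pos hn, Finset.sum_eq_single (i, j)]
    · exact if_pos ⟨hi, hj⟩
    · rintro ⟨i', j'⟩ hmem hne
      rw [Finset.HasAntidiagonal.mem_antidiagonal] at hmem
      refine if_neg fun h => hne ?_
      have := huniq i' j' i j h.1 h.2 hi hj (hmem.trans hij.symm)
      simp only at hmem
      ext <;> simp only <;> omega
    · exact fun h => absurd (Finset.HasAntidiagonal.mem_antidiagonal.2 hij) h
  · rw [if_neg hn]
    refine Finset.sum_eq_zero fun p hp => if_neg fun h => hn ?_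
    exact (hR n).2 ⟨p.1, p.2, h.1, h.2, Finset.HasAntidiagonal.mem_antidiagonal.1 hp⟩

theorem add_mul_mem {T : Set ℕ} {e : ℕ} (hT : ∀ a ∈ T, a + e ∈ T) {a : ℕ} (ha : a ∈ T) (k : ℕ) :
    a + k * e ∈ T := by
  induction k with
  | zero => simpa using ha
  | succ k ih => simpa [add_mul, add_assoc] using hT _ ih

theorem eq_of_mem_aperySet_of_modEq {T : Set ℕ} {e : ℕ} (hT : ∀ a ∈ T, a + e ∈ T) {a b : ℕ}
    (ha : a ∈ aperySet T e) (hb : b ∈ aperySet T e) (h : a ≡ b [MOD e]) : a = b := by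
  wlog hle : a ≤ b generalizing a b
  · exact (this hb ha h.symm (le_of_not_ge hle)).symm
  obtain ⟨k, hk⟩ := (Nat.modEq_iff_dvd' hle).1 h
  cases k with
  | zero => rw [mul_zero] at hk; omega
  | succ k =>
    refine absurd ?_ (hb.2 _ (add_mul_mem hT ha.1 k))
    have : e * (k + 1) = k * e + e := by ring
    omega

theorem exists_aperySet_add_mul {T : Set ℕ} {e : ℕ} (he : 0 < e) {a : ℕ} (ha : a ∈ T) :
    ∃ w ∈ aperySet T e, ∃ k, a = w + k * e := by
  induction a using Nat.strong_induction_on with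
  | _ a ih =>
    by_cases h : ∃ c ∈ T, a = c + e
    · obtain ⟨c, hc, rfl⟩ := h
      obtain ⟨w, hw, k, rfl⟩ := ih c (by omega) hc
      exact ⟨w, hw, k + 1, by ring⟩
    · exact ⟨a, ⟨ha, fun c hc hac => h ⟨c, hc, hac⟩⟩, 0, by simp⟩

/-- For a gluing `S = d₁S₁ + d₂S₂` (with `d₁ ∈ S₂`, `d₂ ∈ S₁` coprime),
`Σ_{n ∈ S} tⁿ = (1 - t^{d₁d₂}) (Σ_{n ∈ S₁} t^{d₁n}) (Σ_{n ∈ S₂} t^{d₂n})` in `ℤ[[t]]`. -/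
theorem stmt13 (S₁ S₂ : Set ℕ)
    (h₁ : IsNumericalSemigroup S₁) (h₂ : IsNumericalSemigroup S₂)
    (d₁ d₂ : ℕ) (hd₁pos : 0 < d₁) (hd₂pos : 0 < d₂)
    (hd₁ : d₁ ∈ S₂) (hd₂ : d₂ ∈ S₁) (hcop : Nat.gcd d₁ d₂ = 1)
    (S : Set ℕ) (hS : S = {m | ∃ a ∈ S₁, ∃ b ∈ S₂, m = d₁ * a + d₂ * b}) :
    PowerSeries.mk (fun m : ℕ => if m ∈ S then (1 : ℤ) else 0) =
      (1 - (PowerSeries.X : PowerSeries ℤ) ^ (d₁ * d₂)) *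
        PowerSeries.mk (fun m : ℕ => if d₁ ∣ m ∧ m / d₁ ∈ S₁ then (1 : ℤ) else 0) *
        PowerSeries.mk (fun m : ℕ => if d₂ ∣ m ∧ m / d₂ ∈ S₂ then (1 : ℤ) else 0) := by
  have hT₁ : ∀ a ∈ S₁, a + d₂ ∈ S₁ := fun a ha => h₁.2.1 a ha d₂ hd₂
  have hT₂ : ∀ b ∈ S₂, b + d₁ ∈ S₂ := fun b hb => h₂.2.1 b hb d₁ hd₁
  rw [one_sub_X_pow_mul_mk_eq_apery hd₁pos hT₁]
  symm
  apply mk_indicator_mul_mk_indicator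
  · intro n
    simp only [dvd_and_div_mem_iff hd₂pos]
    rw [hS]
    constructor
    · rintro ⟨a, ha, b, hb, rfl⟩
      obtain ⟨w, hw, k, rfl⟩ := exists_aperySet_add_mul hd₂pos ha
      exact ⟨_, _, ⟨w, hw, rfl⟩, ⟨b + k * d₁, add_mul_mem hT₂ hb k, rfl⟩, by ring⟩
    · rintro ⟨_, _, ⟨a, ha, rfl⟩, ⟨b, hb, rfl⟩, rfl⟩
      exact ⟨a, ha.1, b, hb, rfl⟩
  · rintro _ _ _ _ ⟨a, ha, rfl⟩ ⟨⟨b, rfl⟩, -⟩ ⟨a', ha', rfl⟩ ⟨⟨b', rfl⟩, -⟩ h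
    have hmod : d₁ * a ≡ d₁ * a' [MOD d₂] := by
      have := congrArg (· % d₂) h
      simpa [Nat.ModEq] using this
    rw [eq_of_mem_aperySet_of_modEq hT₁ ha ha'
      (Nat.ModEq.cancel_left_of_coprime (Nat.gcd_comm d₁ d₂ ▸ hcop) hmod)]
end

section
/- There exists N such that for all n ∈ S with n > N: (i) n + n₁ ∈ S and M_S(n + n₁) = M_S(n) + 1, and (ii) n + n_k ∈ S and m_S(n + n_k) = m_S(n) + 1. In particular, the maximum and minimum factorization length functions M_S and m_S are eventually quasilinear. -/
open scoped Classical

/-- The set of factorization lengths `L_S(z)` of `z`. -/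
def LengthSet (k : ℕ) (n : Fin k → ℕ) (z : ℤ) : Set ℕ :=
  {l | ∃ a : Fin k → ℕ, (∑ i, (a i : ℤ) * (n i : ℤ)) = z ∧ ∑ i, a i = l}

lemma add_one_mem_lengthSet {k : ℕ} {n : Fin k → ℕ} {z : ℤ} {l : ℕ} (j : Fin k)
    (hl : l ∈ LengthSet k n z) : l + 1 ∈ LengthSet k n (z + n j) := by
  obtain ⟨a, rfl, rfl⟩ := hl
  refine ⟨fun i => a i + if i = j then 1 else 0, ?_, ?_⟩
  · simp [add_mul, Finset.sum_add_distrib]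
  · simp [Finset.sum_add_distrib]

/-- A sufficiently large element has, next to any factorization, one that uses `n j`, obtained by
trading `n j` copies of some `n i` for `n i` copies of `n j`. -/
lemma exists_lengthSet_sub_of_large {k : ℕ} {n : Fin k → ℕ} (hpos : ∀ i, 0 < n i) (j : Fin k)
    {z : ℤ} (hz : ∑ i, (n j : ℤ) * n i < z) {l : ℕ} (hl : l ∈ LengthSet k n z) :
    ∃ i, ∃ l' ∈ LengthSet k n (z - n j), l' + 1 + n j = l + n i := by
  obtain ⟨a, rfl, rfl⟩ := hl
  obtain ⟨i, -, hi⟩ := Finset.exists_lt_of_sum_lt hz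
  have hij : n j ≤ a i := by
    exact_mod_cast (lt_of_mul_lt_mul_right hi (Int.natCast_nonneg _)).le
  let b : Fin k → ℕ := fun t =>
    (a t - if t = i then n j else 0) + if t = j then n i - 1 else 0
  have hb (t : Fin k) :
      (b t : ℤ) = (a t - if t = i then (n j : ℤ) else 0) + if t = j then (n i : ℤ) - 1 else 0 := by
    have := hpos i
    dsimp only [b]
    split_ifs with h₁ h₂ h₂ <;> subst_vars <;> omega
  refine ⟨i, ∑ t, b t, ⟨b, ?_, rfl⟩, ?_⟩
  · simp only [hb, add_mul, sub_mul, Finset.sum_add_distrib, Finset.sum_sub_distrib, ite_mul,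
      zero_mul, Finset.sum_ite_eq', Finset.mem_univ, if_true]
    ring
  · zify
    simp only [hb, Finset.sum_add_distrib, Finset.sum_sub_distrib, Finset.sum_ite_eq',
      Finset.mem_univ, if_true]
    ring

lemma bddAbove_lengthSet {k : ℕ} {n : Fin k → ℕ} (hpos : ∀ i, 0 < n i) (z : ℤ) :
    BddAbove (LengthSet k n z) := by
  refine ⟨z.toNat, ?_⟩
  rintro _ ⟨a, rfl, rfl⟩
  have h : ∑ i, a i ≤ ∑ i, a i * n i :=
    Finset.sum_le_sum fun i _ => Nat.le_mul_of_pos_right _ (hpos i)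
  have h' : ((∑ i, a i : ℕ) : ℤ) ≤ ∑ i, (a i : ℤ) * n i := by exact_mod_cast h
  omega

lemma add_mem_semigroupSet {k : ℕ} {n : Fin k → ℕ} {z : ℤ} (j : Fin k)
    (hz : z ∈ SemigroupSet k n) : z + n j ∈ SemigroupSet k n := by
  obtain ⟨a, ha⟩ := hz
  obtain ⟨b, hb, -⟩ := add_one_mem_lengthSet j ⟨a, ha.symm, rfl⟩
  exact ⟨b, hb.symm⟩

lemma lengthSet_nonempty {k : ℕ} {n : Fin k → ℕ} {z : ℤ} (hz : z ∈ SemigroupSet k n) :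
    (LengthSet k n z).Nonempty := by
  obtain ⟨a, ha⟩ := hz
  exact ⟨_, a, ha.symm, rfl⟩

lemma sSup_lengthSet_add {k : ℕ} {n : Fin k → ℕ} (hpos : ∀ i, 0 < n i) {j : Fin k}
    (hj : ∀ i, n j ≤ n i) {z : ℤ} (hzS : z ∈ SemigroupSet k n)
    (hz : ∑ i, (n j : ℤ) * n i < z) :
    sSup (LengthSet k n (z + n j)) = sSup (LengthSet k n z) + 1 := by
  refine le_antisymm (csSup_le' fun l hl => ?_) (le_csSup (bddAbove_lengthSet hpos _)
    (add_one_mem_lengthSet j (Nat.sSup_mem (lengthSet_nonempty hzS) (bddAbove_lengthSet hpos z))))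
  obtain ⟨i, l', hl', h⟩ := exists_lengthSet_sub_of_large hpos j (by omega) hl
  rw [add_sub_cancel_right] at hl'
  have := le_csSup (bddAbove_lengthSet hpos z) hl'
  have := hj i
  omega

lemma sInf_lengthSet_add {k : ℕ} {n : Fin k → ℕ} (hpos : ∀ i, 0 < n i) {j : Fin k}
    (hj : ∀ i, n i ≤ n j) {z : ℤ} (hzS : z ∈ SemigroupSet k n)
    (hz : ∑ i, (n j : ℤ) * n i < z) :
    sInf (LengthSet k n (z + n j)) = sInf (LengthSet k n z) + 1 := by
  refine le_antisymm (Nat.sInf_le (add_one_mem_lengthSet j (Nat.sInf_mem (lengthSet_nonempty hzS))))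
    (le_csInf (lengthSet_nonempty (add_mem_semigroupSet j hzS)) fun l hl => ?_)
  obtain ⟨i, l', hl', h⟩ := exists_lengthSet_sub_of_large hpos j (by omega) hl
  rw [add_sub_cancel_right] at hl'
  have := Nat.sInf_le hl'
  have := hj i
  omega

/-- There exists `N` such that for all `n ∈ S` with `n > N`:
(i) `n + n₁ ∈ S` and `M_S(n + n₁) = M_S(n) + 1`, and
(ii) `n + n_k ∈ S` and `m_S(n + n_k) = m_S(n) + 1`.
In particular `M_S` and `m_S` are eventually quasilinear. -/
theorem stmt19 (k : ℕ) (hk : 0 < k) (n : Fin k → ℕ)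
    (hpos : ∀ i, 0 < n i) (hmono : StrictMono n)
    (hgcd : Finset.univ.gcd n = 1) :
    ∃ N : ℤ, ∀ z : ℤ, z ∈ SemigroupSet k n → N < z →
      ((z + (n ⟨0, hk⟩ : ℤ)) ∈ SemigroupSet k n ∧
        sSup (LengthSet k n (z + (n ⟨0, hk⟩ : ℤ))) = sSup (LengthSet k n z) + 1) ∧
      ((z + (n ⟨k - 1, Nat.sub_lt hk Nat.one_pos⟩ : ℤ)) ∈ SemigroupSet k n ∧
        sInf (LengthSet k n (z + (n ⟨k - 1, Nat.sub_lt hk Nat.one_pos⟩ : ℤ))) =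
          sInf (LengthSet k n z) + 1) := by
  refine ⟨max (∑ i, (n ⟨0, hk⟩ : ℤ) * n i)
    (∑ i, (n ⟨k - 1, Nat.sub_lt hk Nat.one_pos⟩ : ℤ) * n i), fun z hzS hz => ?_⟩
  obtain ⟨hz₁, hz₂⟩ := max_lt_iff.mp hz
  refine ⟨⟨add_mem_semigroupSet _ hzS, sSup_lengthSet_add hpos (fun i => ?_) hzS hz₁⟩,
    ⟨add_mem_semigroupSet _ hzS, sInf_lengthSet_add hpos (fun i => ?_) hzS hz₂⟩⟩
  · exact hmono.monotone (Fin.mk_le_of_le_val (Nat.zero_le _))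
  · exact hmono.monotone (Fin.le_def.mpr (Nat.le_sub_one_of_lt i.isLt))
end
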